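/- Let μ(θ) ∝ exp(−U(θ)) be a probability density on ℝ^d with U twice continuously differentiable and ∇²U(θ) ⪰ mI for all θ, for some m > 0. Let f : ℝ^d → ℝ be L-Lipschitz with E_μ(f) = 0. Then for all 0 ≤ λ ≤ m/(6L²), E_μ[exp(λ(f² − E_μ(f²)))] ≤ exp(4λ²L⁴/m²). -/

import Mathlib

/-!
STATEMENT 17: If μ ∝ exp(−U) on ℝ^d with U twice continuously differentiable and
∇²U ⪰ mI (m > 0), and f is L-Lipschitz with E_μ(f) = 0, then for 0 ≤ λ ≤ m/(6L²),
E_μ[exp(λ(f² − E_μ(f²)))] ≤ exp(4λ²L⁴/m²).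
-/

open MeasureTheory
open scoped ENNReal RealInnerProductSpace

noncomputable section

abbrev EV (n : ℕ) := EuclideanSpace ℝ (Fin n)

/-- Probability measure with (unnormalized) density `f` w.r.t. the volume measure. -/
def densMeasure {α : Type*} [MeasureSpace α] (f : α → ℝ) : Measure α :=
  (∫⁻ x, ENNReal.ofReal (f x))⁻¹ • (volume.withDensity fun x => ENNReal.ofReal (f x))

section BM
open scoped Pointwise

lemma bm_compact (t s : ℝ) (ht : 0 < t) (hs : 0 < s) (K L C : Set ℝ) (hK : IsCompact K) (hL : IsCompact L)
    (hKn : K.Nonempty) (hLn : L.Nonempty) (h : ∀ x ∈ K, ∀ y ∈ L, t * x + s * y ∈ C) :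
    ENNReal.ofReal t * volume K + ENNReal.ofReal s * volume L ≤ volume C := by
  obtain ⟨a, ha, hamax⟩ := hK.exists_isGreatest hKn
  obtain ⟨b, hb, hbmin⟩ := hL.exists_isLeast hLn
  have vol : ∀ (r : ℝ) (c : ℝ) (S : Set ℝ), 0 < r →
      volume ((fun x => r * x + c) '' S) = ENNReal.ofReal r * volume S := by
    intro r c S hr
    have : (fun x => r * x + c) '' S = (fun x => x + c) '' (r • S) := by
      rw [← Set.image_smul, Set.image_image]; rfl
    rw [this, Set.image_add_right, measure_preimage_add_right, Measure.addHaar_smul]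
    simp [abs_of_pos hr]
  have hKm : IsCompact ((fun x => t * x + s * b) '' K) := hK.image (by fun_prop)
  have hLm : IsCompact ((fun x => s * x + t * a) '' L) := hL.image (by fun_prop)
  have hun := measure_union_add_inter (μ := volume) ((fun x => t * x + s * b) '' K) hLm.measurableSet
  rw [vol t _ K ht, vol s _ L hs] at hun
  have hint : volume ((fun x => t * x + s * b) '' K ∩ (fun x => s * x + t * a) '' L) = 0 := by
    refine measure_mono_null (t := {t * a + s * b}) ?_ (by simp)
    rintro z ⟨⟨x, hx, rfl⟩, ⟨y, hy, hxy⟩⟩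
    have h1 := hamax hx
    have h2 := hbmin hy
    simp only at hxy
    have h3 := mul_le_mul_of_nonneg_left h1 ht.le
    have h4 := mul_le_mul_of_nonneg_left h2 hs.le
    simp only [Set.mem_singleton_iff]
    linarith
  rw [hint, add_zero] at hun
  rw [← hun]
  apply measure_mono
  rintro z (⟨x, hx, rfl⟩ | ⟨y, hy, rfl⟩)
  · exact h x hx b hb
  · have := h a ha y hy
    simpa [add_comm] using this

lemma bm_meas (t s : ℝ) (ht : 0 < t) (hs : 0 < s) (A B C : Set ℝ) (hA : MeasurableSet A) (hB : MeasurableSet B)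
    (hAn : A.Nonempty) (hBn : B.Nonempty) (h : ∀ x ∈ A, ∀ y ∈ B, t * x + s * y ∈ C) :
    ENNReal.ofReal t * volume A + ENNReal.ofReal s * volume B ≤ volume C := by
  obtain ⟨a, ha⟩ := hAn
  obtain ⟨b, hb⟩ := hBn
  rw [hA.measure_eq_iSup_isCompact, hB.measure_eq_iSup_isCompact]
  simp only [ENNReal.mul_iSup]
  simp only [iSup_and']
  refine ENNReal.biSup_add_biSup_le' ⟨∅, by simp⟩ ⟨∅, by simp⟩ ?_
  rintro K ⟨hKA, hK⟩ L ⟨hLB, hL⟩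
  refine le_trans ?_ (bm_compact t s ht hs (insert a K) (insert b L) C (hK.insert a) (hL.insert b)
    (by simp) (by simp) ?_)
  · gcongr <;> simp
  · intro x hx y hy
    exact h x (Set.insert_subset ha hKA hx) y (Set.insert_subset hb hLB hy)

lemma young_w (t s : ℝ) (ht : 0 < t) (hs : 0 < s) (hts : t + s = 1) (a b : ℝ≥0∞) :
    a ^ t * b ^ s ≤ ENNReal.ofReal t * a + ENNReal.ofReal s * b := by
  have h := ENNReal.young_inequality (a ^ t) (b ^ s) (p := t⁻¹) (q := s⁻¹)
    (by constructor <;> simp [hts, ht, hs])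
  rw [← ENNReal.rpow_mul, ← ENNReal.rpow_mul, mul_inv_cancel₀ ht.ne', mul_inv_cancel₀ hs.ne',
    ENNReal.rpow_one, ENNReal.rpow_one, ENNReal.ofReal_inv_of_pos ht, ENNReal.ofReal_inv_of_pos hs] at h
  simpa [div_eq_mul_inv, mul_comm] using h

lemma lc (f : ℝ → ℝ≥0∞) (hf : Measurable f) (h1 : ∀ x, f x ≤ 1) :
    ∫⁻ x, f x = ∫⁻ r in Set.Ioi (0:ℝ), volume {x | ENNReal.ofReal r < f x} := by
  have h2 : ∀ x, f x ≠ ∞ := fun x => ne_top_of_le_ne_top ENNReal.one_ne_top (h1 x)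
  have := lintegral_eq_lintegral_meas_lt (volume : Measure ℝ) (f := fun x => (f x).toReal)
    (Filter.Eventually.of_forall fun x => ENNReal.toReal_nonneg) (hf.ennreal_toReal.aemeasurable)
  simp only [ENNReal.ofReal_toReal (h2 _)] at this
  rw [this]
  refine setLIntegral_congr_fun measurableSet_Ioi fun r hr => ?_
  congr 1
  ext x
  simp [ENNReal.ofReal_lt_iff_lt_toReal (le_of_lt hr) (h2 x)]

lemma pl_norm (t s : ℝ) (ht : 0 < t) (hs : 0 < s) (hts : t + s = 1) (f g h : ℝ → ℝ≥0∞)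
    (hf : Measurable f) (hg : Measurable g) (hh : Measurable h)
    (hfs : ⨆ x, f x = 1) (hgs : ⨆ x, g x = 1)
    (H : ∀ x y, f x ^ t * g y ^ s ≤ h (t * x + s * y)) :
    (∫⁻ x, f x) ^ t * (∫⁻ x, g x) ^ s ≤ ∫⁻ x, h x := by
  refine (young_w t s ht hs hts _ _).trans ?_
  have hf1 : ∀ x, f x ≤ 1 := fun x => hfs ▸ le_iSup f x
  have hg1 : ∀ x, g x ≤ 1 := fun x => hgs ▸ le_iSup g x
  refine le_trans ?_ (lintegral_mono (fun x => min_le_left (h x) 1))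
  rw [lc f hf hf1, lc g hg hg1, lc _ (hh.min measurable_const) (fun x => min_le_right _ _)]
  have mm : ∀ k : ℝ → ℝ≥0∞, Measurable fun r : ℝ => volume {x | ENNReal.ofReal r < k x} := by
    intro k
    apply Antitone.measurable
    intro r r' hr
    apply measure_mono
    intro x hx
    exact lt_of_le_of_lt (ENNReal.ofReal_le_ofReal hr) hx
  rw [← lintegral_const_mul _ (mm f), ← lintegral_const_mul _ (mm g), ← lintegral_add_left ((mm f).const_mul _)]
  refine setLIntegral_mono (mm _) fun r hr => ?_
  rcases lt_or_ge r 1 with h1 | h1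
  · have hr1 : ENNReal.ofReal r < 1 := by simpa using h1
    refine bm_meas t s ht hs _ _ _ (measurableSet_lt measurable_const hf)
      (measurableSet_lt measurable_const hg) ?_ ?_ ?_
    · rw [← hfs] at hr1; exact lt_iSup_iff.1 hr1
    · rw [← hgs] at hr1; exact lt_iSup_iff.1 hr1
    · intro x hx y hy
      have hx' : ENNReal.ofReal r < f x := hx
      have hy' : ENNReal.ofReal r < g y := hy
      refine lt_min (lt_of_lt_of_le ?_ (H x y)) hr1
      calc ENNReal.ofReal r = ENNReal.ofReal r ^ t * ENNReal.ofReal r ^ s := by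
            rw [← ENNReal.rpow_add _ _ (by simpa using hr) (by simp), hts, ENNReal.rpow_one]
        _ < _ := ENNReal.mul_lt_mul (ENNReal.rpow_lt_rpow hx' ht) (ENNReal.rpow_lt_rpow hy' hs)
  · have hr1 : (1 : ℝ≥0∞) ≤ ENNReal.ofReal r := by simpa using h1
    have e1 : {x | ENNReal.ofReal r < f x} = ∅ := by
      ext x; simpa using (hf1 x).trans hr1
    have e2 : {x | ENNReal.ofReal r < g x} = ∅ := by
      ext x; simpa using (hg1 x).trans hr1
    rw [e1, e2]; simp

lemma pl_bdd (t s : ℝ) (ht : 0 < t) (hs : 0 < s) (hts : t + s = 1) (f g h : ℝ → ℝ≥0∞)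
    (hf : Measurable f) (hg : Measurable g) (hh : Measurable h)
    (hfs : ⨆ x, f x ≠ ∞) (hgs : ⨆ x, g x ≠ ∞)
    (H : ∀ x y, f x ^ t * g y ^ s ≤ h (t * x + s * y)) :
    (∫⁻ x, f x) ^ t * (∫⁻ x, g x) ^ s ≤ ∫⁻ x, h x := by
  set M := ⨆ x, f x with hM
  set N := ⨆ x, g x with hN
  by_cases hM0 : M = 0
  · have : ∀ x, f x = 0 := by simpa [hM] using hM0
    simp [this, ht]
  by_cases hN0 : N = 0
  · have : ∀ x, g x = 0 := by simpa [hN] using hN0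
    simp [this, hs]
  have key := pl_norm t s ht hs hts (fun x => M⁻¹ * f x) (fun x => N⁻¹ * g x)
    (fun x => (M⁻¹ ^ t * N⁻¹ ^ s) * h x) (hf.const_mul _) (hg.const_mul _) (hh.const_mul _)
    (by rw [← ENNReal.mul_iSup]; exact ENNReal.inv_mul_cancel hM0 hfs)
    (by rw [← ENNReal.mul_iSup]; exact ENNReal.inv_mul_cancel hN0 hgs)
    (by
      intro x y
      rw [ENNReal.mul_rpow_of_nonneg _ _ ht.le, ENNReal.mul_rpow_of_nonneg _ _ hs.le,
        mul_mul_mul_comm]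
      gcongr
      exact H x y)
  rw [lintegral_const_mul _ hf, lintegral_const_mul _ hg, lintegral_const_mul _ hh,
    ENNReal.mul_rpow_of_nonneg _ _ ht.le, ENNReal.mul_rpow_of_nonneg _ _ hs.le,
        mul_mul_mul_comm] at key
  refine (ENNReal.mul_le_mul_iff_right ?_ ?_).1 key
  · simp [hfs, hgs, hM0, hN0, ht, hs, ENNReal.rpow_eq_zero_iff]
  · apply ENNReal.mul_ne_top <;> apply ENNReal.rpow_ne_top_of_nonneg <;> simp [hM0, hN0, ht.le, hs.le]

lemma trunc_tendsto {α : Type*} [MeasurableSpace α] (μ : Measure α) (f : α → ℝ≥0∞) (hf : Measurable f) :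
    Filter.Tendsto (fun n : ℕ => ∫⁻ x, min (f x) n ∂μ) Filter.atTop (nhds (∫⁻ x, f x ∂μ)) := by
  apply lintegral_tendsto_of_tendsto_of_monotone
  · intro n; exact (hf.min measurable_const).aemeasurable
  · refine Filter.Eventually.of_forall fun x a b hab => ?_
    simp only
    gcongr
  · refine Filter.Eventually.of_forall fun x => ?_
    have := (tendsto_const_nhds (x := f x)).min ENNReal.tendsto_nat_nhds_top
    simpa using this

lemma pl_one (t s : ℝ) (ht : 0 < t) (hs : 0 < s) (hts : t + s = 1) (f g h : ℝ → ℝ≥0∞)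
    (hf : Measurable f) (hg : Measurable g) (hh : Measurable h)
    (H : ∀ x y, f x ^ t * g y ^ s ≤ h (t * x + s * y)) :
    (∫⁻ x, f x) ^ t * (∫⁻ x, g x) ^ s ≤ ∫⁻ x, h x := by
  by_cases hf0 : ∫⁻ x, f x = 0
  · simp [hf0, ht]
  by_cases hg0 : ∫⁻ x, g x = 0
  · simp [hg0, hs]
  have hT : Filter.Tendsto (fun n : ℕ => (∫⁻ x, min (f x) n) ^ t * (∫⁻ x, min (g x) n) ^ s) Filter.atTop
      (nhds ((∫⁻ x, f x) ^ t * (∫⁻ x, g x) ^ s)) := by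
    refine ENNReal.Tendsto.mul ((trunc_tendsto _ f hf).ennrpow_const t) (Or.inl ?_)
      ((trunc_tendsto _ g hg).ennrpow_const s) (Or.inl ?_)
    · simp [ENNReal.rpow_eq_zero_iff, hf0, ht.le]
    · simp [ENNReal.rpow_eq_zero_iff, hg0, hs.le]
  refine le_of_tendsto' hT fun n => ?_
  refine pl_bdd t s ht hs hts _ _ h (hf.min measurable_const) (hg.min measurable_const) hh ?_ ?_ ?_
  · exact ne_top_of_le_ne_top (ENNReal.natCast_ne_top n) (iSup_le fun x => min_le_right _ _)
  · exact ne_top_of_le_ne_top (ENNReal.natCast_ne_top n) (iSup_le fun x => min_le_right _ _)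
  · intro x y
    refine le_trans ?_ (H x y)
    gcongr <;> exact min_le_left _ _

lemma pl_cons_eq (n : ℕ) (p : ℝ × (Fin n → ℝ)) :
    (MeasurableEquiv.piFinSuccAbove (fun _ : Fin (n+1) => ℝ) 0).symm p
      = (Fin.cons p.1 p.2 : Fin (n+1) → ℝ) := by
  have : (MeasurableEquiv.piFinSuccAbove (fun _ : Fin (n+1) => ℝ) 0).symm p
      = (Fin.insertNth 0 p.1 p.2 : Fin (n+1) → ℝ) := rfl
  rw [this, Fin.insertNth_zero]
  rfl

lemma pl_cons_meas (n : ℕ) (f : (Fin (n+1) → ℝ) → ℝ≥0∞) (hf : Measurable f) :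
    Measurable fun p : ℝ × (Fin n → ℝ) => f (Fin.cons p.1 p.2) := by
  have := hf.comp (MeasurableEquiv.piFinSuccAbove (fun _ : Fin (n+1) => ℝ) 0).symm.measurable
  simpa only [Function.comp_def, pl_cons_eq] using this

lemma pl_split (n : ℕ) (f : (Fin (n+1) → ℝ) → ℝ≥0∞) (hf : Measurable f) :
    ∫⁻ x, f x = ∫⁻ x : ℝ, ∫⁻ y : Fin n → ℝ, f (Fin.cons x y) := by
  have e := (volume_preserving_piFinSuccAbove (fun _ : Fin (n+1) => ℝ) 0).symm
  rw [← e.lintegral_comp hf]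
  simp only [pl_cons_eq]
  rw [Measure.volume_eq_prod, lintegral_prod _ (pl_cons_meas n f hf).aemeasurable]

lemma pl_pi (t s : ℝ) (ht : 0 < t) (hs : 0 < s) (hts : t + s = 1) (n : ℕ) : ∀ (f g h : (Fin n → ℝ) → ℝ≥0∞)
    (_ : Measurable f) (_ : Measurable g) (_ : Measurable h)
    (_ : ∀ x y, f x ^ t * g y ^ s ≤ h (t • x + s • y)),
    (∫⁻ x, f x) ^ t * (∫⁻ x, g x) ^ s ≤ ∫⁻ x, h x := by
  induction n with
  | zero =>
    intro f g h hf hg hh H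
    have hv : (volume : Measure (Fin 0 → ℝ)) = Measure.dirac 0 := by
      rw [volume_pi, Measure.pi_of_empty _ 0]
    rw [hv, lintegral_dirac, lintegral_dirac, lintegral_dirac]
    simpa using H 0 0
  | succ n ih =>
    intro f g h hf hg hh H
    rw [pl_split n f hf, pl_split n g hg, pl_split n h hh]
    have mf := pl_cons_meas n f hf
    have mg := pl_cons_meas n g hg
    have mh := pl_cons_meas n h hh
    refine pl_one t s ht hs hts _ _ _ mf.lintegral_prod_right' mg.lintegral_prod_right' mh.lintegral_prod_right' ?_
    intro x y
    refine ih _ _ _ (mf.comp measurable_prodMk_left) (mg.comp measurable_prodMk_left)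
      (mh.comp measurable_prodMk_left) ?_
    intro u v
    refine (H _ _).trans (le_of_eq ?_)
    congr 1
    ext i
    refine Fin.cases ?_ (fun j => ?_) i <;> simp

lemma pl_ev (t s : ℝ) (ht : 0 < t) (hs : 0 < s) (hts : t + s = 1) (n : ℕ) (f g h : EuclideanSpace ℝ (Fin n) → ℝ≥0∞)
    (hf : Measurable f) (hg : Measurable g) (hh : Measurable h)
    (H : ∀ x y, f x ^ t * g y ^ s ≤ h (t • x + s • y)) :
    (∫⁻ x, f x) ^ t * (∫⁻ x, g x) ^ s ≤ ∫⁻ x, h x := by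
  have e := PiLp.volume_preserving_toLp (Fin n)
  rw [← e.lintegral_comp hf, ← e.lintegral_comp hg, ← e.lintegral_comp hh]
  refine pl_pi t s ht hs hts n _ _ _ (hf.comp e.measurable) (hg.comp e.measurable) (hh.comp e.measurable) ?_
  intro x y
  exact H _ _

end BM

lemma line_convex {d : ℕ} (U : EV d → ℝ) (m : ℝ) 
    (hC2 : ContDiff ℝ 2 U)
    (hHess : ∀ θ v : EV d, m * ‖v‖ ^ 2 ≤ ⟪v, fderiv ℝ (gradient U) θ v⟫) (x v : EV d) :
    ConvexOn ℝ Set.univ (fun τ : ℝ => U (x + τ • v) - m / 2 * ‖v‖ ^ 2 * τ ^ 2) ∧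
    HasDerivAt (fun τ : ℝ => U (x + τ • v) - m / 2 * ‖v‖ ^ 2 * τ ^ 2) ⟪gradient U x, v⟫ 0 := by
  have hline : ∀ τ : ℝ, HasDerivAt (fun τ : ℝ => x + τ • v) v τ := fun τ => by
    simpa using ((hasDerivAt_id τ).smul_const v).const_add x
  have hUd : Differentiable ℝ U := hC2.differentiable (by norm_num)
  have hg : Differentiable ℝ (gradient U) := by
    have h1 : Differentiable ℝ (fderiv ℝ U) := 
      (hC2.fderiv_right (m := 1) (by norm_num)).differentiable (by norm_num)
    have : gradient U = fun x => (InnerProductSpace.toDual ℝ (EV d)).symm (fderiv ℝ U x) := rfl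
    rw [this]
    exact ((InnerProductSpace.toDual ℝ (EV d)).symm.toContinuousLinearEquiv.differentiable).comp h1
  have hd1 : ∀ τ : ℝ, HasDerivAt (fun τ : ℝ => U (x + τ • v) - m / 2 * ‖v‖ ^ 2 * τ ^ 2)
      (⟪gradient U (x + τ • v), v⟫ - m * ‖v‖ ^ 2 * τ) τ := by
    intro τ
    have h1 := (hUd (x + τ • v)).hasFDerivAt.comp_hasDerivAt τ (hline τ)
    have h2 := ((hasDerivAt_pow 2 τ).const_mul (m / 2 * ‖v‖ ^ 2))
    convert! h1.sub h2 using 1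
    rw [inner_gradient_left]
    simp; ring
  have hd2 : ∀ τ : ℝ, HasDerivAt (fun τ : ℝ => ⟪gradient U (x + τ • v), v⟫ - m * ‖v‖ ^ 2 * τ)
      (⟪fderiv ℝ (gradient U) (x + τ • v) v, v⟫ - m * ‖v‖ ^ 2) τ := by
    intro τ
    have h1 := ((hg (x + τ • v)).hasFDerivAt.comp_hasDerivAt τ (hline τ)).inner ℝ (hasDerivAt_const τ v)
    have h2 := (hasDerivAt_id τ).const_mul (m * ‖v‖ ^ 2)
    convert! h1.sub h2 using 1
    simp
  constructor
  · refine convexOn_of_hasDerivWithinAt2_nonneg convex_univ 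
      (fun τ _ => (hd1 τ).continuousAt.continuousWithinAt)
      (fun τ _ => (hd1 τ).hasDerivWithinAt) (fun τ _ => (hd2 τ).hasDerivWithinAt) ?_
    intro τ _
    have := hHess (x + τ • v) v
    rw [real_inner_comm] at this
    linarith
  · simpa using hd1 0

lemma strong_conv {d : ℕ} (U : EV d → ℝ) (m : ℝ) 
    (hC2 : ContDiff ℝ 2 U)
    (hHess : ∀ θ v : EV d, m * ‖v‖ ^ 2 ≤ ⟪v, fderiv ℝ (gradient U) θ v⟫) (t s : ℝ) (ht : 0 < t)
    (hs : 0 < s) (hts : t + s = 1) (x y : EV d) :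
    U (t • x + s • y) ≤ t * U x + s * U y - t * s * (m / 2) * ‖x - y‖ ^ 2 := by
  have h := (line_convex U m hC2 hHess y (x - y)).1.2 (Set.mem_univ 1) (Set.mem_univ 0) ht.le hs.le hts
  have e : y + t • (x - y) = t • x + s • y := by
    have : s = 1 - t := by linarith
    rw [this, smul_sub, sub_smul, one_smul]; abel
  simp at h
  rw [e] at h
  have : s = 1 - t := by linarith
  subst this
  nlinarith [h]

lemma lower_bd {d : ℕ} (U : EV d → ℝ) (m : ℝ) (hm : 0 < m)
    (hC2 : ContDiff ℝ 2 U)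
    (hHess : ∀ θ v : EV d, m * ‖v‖ ^ 2 ≤ ⟪v, fderiv ℝ (gradient U) θ v⟫) :
    ∃ c : ℝ, ∀ x, c + m / 4 * ‖x‖ ^ 2 ≤ U x := by
  refine ⟨U 0 - ‖gradient U 0‖ ^ 2 / m, fun x => ?_⟩
  obtain ⟨h1, h2⟩ := line_convex U m hC2 hHess 0 x
  have h3 := h1.le_slope_of_hasDerivAt (Set.mem_univ 0) (Set.mem_univ 1) one_pos h2
  simp [slope_def_field, -inner_gradient_left] at h3
  have h4 := abs_real_inner_le_norm (gradient U 0) x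
  have h5 := neg_le_of_abs_le h4
  have h6 : ‖gradient U 0‖ * ‖x‖ ≤ ‖gradient U 0‖ ^ 2 / m + m / 4 * ‖x‖ ^ 2 := by
    have : ‖gradient U 0‖ ^ 2 / m + m / 4 * ‖x‖ ^ 2 - ‖gradient U 0‖ * ‖x‖ = 
      (‖gradient U 0‖ - m / 2 * ‖x‖) ^ 2 / m := by field_simp; ring
    have h7 : 0 ≤ (‖gradient U 0‖ - m / 2 * ‖x‖) ^ 2 / m := by positivity
    linarith
  linarith

lemma integ_base {d : ℕ} (U : EV d → ℝ) (m : ℝ) (hm : 0 < m)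
    (hC2 : ContDiff ℝ 2 U)
    (hHess : ∀ θ v : EV d, m * ‖v‖ ^ 2 ≤ ⟪v, fderiv ℝ (gradient U) θ v⟫) :
    Integrable (fun x => (1 + ‖x‖ ^ 2) * Real.exp (-U x)) (volume : Measure (EV d)) := by
  obtain ⟨c, hc⟩ := lower_bd U m hm hC2 hHess
  have hG : Integrable (fun x : EV d => Real.exp (-(m / 8) * ‖x‖ ^ 2)) := by
    have := (GaussianFourier.integrable_cexp_neg_mul_sq_norm_add (V := EV d) (b := ((m / 8 : ℝ) : ℂ))
      (by simpa using hm) 0 0).norm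
    refine this.congr (Filter.Eventually.of_forall fun x => ?_)
    simp only
    rw [Complex.norm_exp]
    congr 1
    simp [← Complex.ofReal_pow]
  have hUc : Continuous U := hC2.continuous
  refine (hG.const_mul ((1 + 8 / m) * Real.exp (-c))).mono' 
    (by fun_prop) (Filter.Eventually.of_forall fun x => ?_)
  rw [Real.norm_of_nonneg (by positivity)]
  have h1 : Real.exp (-U x) ≤ Real.exp (-c) * Real.exp (-(m / 8) * ‖x‖ ^ 2) * Real.exp (-(m / 8) * ‖x‖ ^ 2) := by
    rw [← Real.exp_add, ← Real.exp_add]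
    apply Real.exp_le_exp.2
    linarith [hc x]
  have h2 : (1 + ‖x‖ ^ 2) ≤ (1 + 8 / m) * Real.exp ((m / 8) * ‖x‖ ^ 2) := by
    have h3 := Real.add_one_le_exp ((m / 8) * ‖x‖ ^ 2)
    have h4 : (1 + 8 / m) * (m / 8 * ‖x‖ ^ 2 + 1) ≤ (1 + 8 / m) * Real.exp ((m / 8) * ‖x‖ ^ 2) := by
      gcongr
    have h5 : (1 + 8 / m) * (m / 8 * ‖x‖ ^ 2 + 1) = 1 + ‖x‖ ^ 2 + m / 8 * ‖x‖ ^ 2 + 8 / m := by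
      field_simp; ring
    have : 0 ≤ m / 8 * ‖x‖ ^ 2 + 8 / m := by positivity
    linarith
  calc _ ≤ ((1 + 8 / m) * Real.exp ((m / 8) * ‖x‖ ^ 2)) * (Real.exp (-c) * Real.exp (-(m / 8) * ‖x‖ ^ 2) * Real.exp (-(m / 8) * ‖x‖ ^ 2)) := by gcongr
    _ = (1 + 8 / m) * Real.exp (-c) * Real.exp (-(m / 8) * ‖x‖ ^ 2) * (Real.exp ((m / 8) * ‖x‖ ^ 2) * Real.exp (-(m / 8) * ‖x‖ ^ 2)) := by ring
    _ = _ := by rw [← Real.exp_add]; simp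

lemma Z_props {d : ℕ} (U : EV d → ℝ) (m : ℝ) (hm : 0 < m)
    (hC2 : ContDiff ℝ 2 U)
    (hHess : ∀ θ v : EV d, m * ‖v‖ ^ 2 ≤ ⟪v, fderiv ℝ (gradient U) θ v⟫) :
    (∫⁻ x : EV d, ENNReal.ofReal (Real.exp (-U x))) ≠ 0 ∧ 
    (∫⁻ x : EV d, ENNReal.ofReal (Real.exp (-U x))) ≠ ∞ := by
  have hUc : Continuous U := hC2.continuous
  constructor
  · intro h
    rw [lintegral_eq_zero_iff (by fun_prop)] at h
    have h2 : ∀ᵐ x : EV d, False := by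
      filter_upwards [h] with x hx
      simp at hx
      exact absurd hx (not_le.2 (Real.exp_pos _))
    simp at h2
    exact NeZero.ne (volume : Measure (EV d)) h2
  · have h := (integ_base U m hm hC2 hHess).lintegral_lt_top
    refine ne_top_of_le_ne_top h.ne (lintegral_mono fun x => ENNReal.ofReal_le_ofReal ?_)
    have := Real.exp_pos (-U x)
    nlinarith [sq_nonneg ‖x‖]

lemma dens_prob {d : ℕ} (U : EV d → ℝ) (m : ℝ) (hm : 0 < m)
    (hC2 : ContDiff ℝ 2 U)
    (hHess : ∀ θ v : EV d, m * ‖v‖ ^ 2 ≤ ⟪v, fderiv ℝ (gradient U) θ v⟫) :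
    IsProbabilityMeasure (densMeasure fun θ => Real.exp (-U θ)) := by
  obtain ⟨h0, h1⟩ := Z_props U m hm hC2 hHess
  constructor
  simp [densMeasure, ENNReal.inv_mul_cancel h0 h1]

lemma dens_integ {d : ℕ} (U : EV d → ℝ) (m : ℝ) (hm : 0 < m)
    (hC2 : ContDiff ℝ 2 U)
    (hHess : ∀ θ v : EV d, m * ‖v‖ ^ 2 ≤ ⟪v, fderiv ℝ (gradient U) θ v⟫) (g : EV d → ℝ)
    (hg : Continuous g) (C : ℝ) (hC : ∀ x, |g x| ≤ C * (1 + ‖x‖ ^ 2)) :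
    Integrable g (densMeasure fun θ => Real.exp (-U θ)) := by
  obtain ⟨h0, h1⟩ := Z_props U m hm hC2 hHess
  have hUc : Continuous U := hC2.continuous
  unfold densMeasure
  refine Integrable.smul_measure ?_ (by simpa using h0)
  rw [integrable_withDensity_iff_integrable_smul' (by fun_prop) (by simp)]
  refine ((integ_base U m hm hC2 hHess).const_mul C).mono' ?_
    (Filter.Eventually.of_forall fun x => ?_)
  · simp only [ENNReal.toReal_ofReal (Real.exp_pos _).le]
    fun_prop
  rw [ENNReal.toReal_ofReal (Real.exp_pos _).le, norm_smul, Real.norm_of_nonneg (Real.exp_pos _).le,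
    Real.norm_eq_abs]
  have := mul_le_mul_of_nonneg_left (hC x) (Real.exp_pos (-U x)).le
  linarith

lemma dens_lint {d : ℕ} (U : EV d → ℝ) (hU : Continuous U) (g : EV d → ℝ≥0∞) (hg : Measurable g) :
    ∫⁻ x, g x ∂(densMeasure fun θ => Real.exp (-U θ)) = 
      (∫⁻ x : EV d, ENNReal.ofReal (Real.exp (-U x)))⁻¹ * ∫⁻ x, ENNReal.ofReal (Real.exp (-U x)) * g x := by
  unfold densMeasure
  rw [lintegral_smul_measure, lintegral_withDensity_eq_lintegral_mul _ (by fun_prop) hg]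
  rfl

lemma jensen_exp {α : Type*} [MeasurableSpace α] (μ : Measure α) [IsProbabilityMeasure μ] (F : α → ℝ)
    (hF : Integrable F μ) : 
    ENNReal.ofReal (Real.exp (∫ x, F x ∂μ)) ≤ ∫⁻ x, ENNReal.ofReal (Real.exp (F x)) ∂μ := by
  set E := ∫ x, F x ∂μ with hE
  set G : α → ℝ := fun x => Real.exp E * (1 + (F x - E)) with hG
  have hGi : Integrable G μ := ((integrable_const _).add (hF.sub (integrable_const _))).const_mul _
  have hGE : ∫ x, G x ∂μ = Real.exp E := by
    rw [hG, integral_const_mul, integral_add (integrable_const _) (by exact hF.sub (integrable_const _)),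
      integral_sub hF (integrable_const _)]
    simp [← hE]
  have hGF : ∀ x, G x ≤ Real.exp (F x) := by
    intro x
    have h1 := Real.add_one_le_exp (F x - E)
    have h2 : Real.exp (F x) = Real.exp E * Real.exp (F x - E) := by rw [← Real.exp_add]; congr 1; ring
    rw [h2]
    exact mul_le_mul_of_nonneg_left (by linarith) (Real.exp_pos _).le
  calc ENNReal.ofReal (Real.exp E) = ENNReal.ofReal (∫ x, G x ∂μ) := by rw [hGE]
    _ ≤ ENNReal.ofReal (∫ x, max (G x) 0 ∂μ) := 
      ENNReal.ofReal_le_ofReal (integral_mono hGi hGi.pos_part fun x => le_max_left _ _)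
    _ = ∫⁻ x, ENNReal.ofReal (max (G x) 0) ∂μ := 
      ofReal_integral_eq_lintegral_ofReal hGi.pos_part (Filter.Eventually.of_forall fun x => le_max_right _ _)
    _ ≤ _ := lintegral_mono fun x => ENNReal.ofReal_le_ofReal (max_le (hGF x) (Real.exp_pos _).le)

lemma transport {d : ℕ} (U : EV d → ℝ) (m : ℝ) (hm : 0 < m)
    (hC2 : ContDiff ℝ 2 U)
    (hHess : ∀ θ v : EV d, m * ‖v‖ ^ 2 ≤ ⟪v, fderiv ℝ (gradient U) θ v⟫) (t s : ℝ) (ht : 0 < t)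
    (hs : 0 < s) (hts : t + s = 1) (P F : EV d → ℝ) (hP : Continuous P) (hF : Continuous F)
    (hFi : Integrable F (densMeasure fun θ => Real.exp (-U θ)))
    (hPF : ∀ x y, P x ≤ F y + s * m / 2 * ‖x - y‖ ^ 2) :
    Integrable (fun x => Real.exp (P x)) (densMeasure fun θ => Real.exp (-U θ)) ∧
    ∫ x, Real.exp (P x) ∂(densMeasure fun θ => Real.exp (-U θ)) ≤ 
      Real.exp (∫ x, F x ∂(densMeasure fun θ => Real.exp (-U θ))) := by
  have hprob := dens_prob U m hm hC2 hHess
  obtain ⟨h0, h1⟩ := Z_props U m hm hC2 hHess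
  have hUc : Continuous U := hC2.continuous
  set μ := (densMeasure fun θ => Real.exp (-U θ)) with hμ
  set Z := (∫⁻ x : EV d, ENNReal.ofReal (Real.exp (-U x))) with hZ
  set E := ∫ x, F x ∂μ with hE
  have hpl := pl_ev t s ht hs hts d 
    (fun x => ENNReal.ofReal (Real.exp (-U x)) * ENNReal.ofReal (Real.exp (P x)))
    (fun x => ENNReal.ofReal (Real.exp (-U x)) * ENNReal.ofReal (Real.exp (-(t / s) * F x)))
    (fun x => ENNReal.ofReal (Real.exp (-U x))) (by fun_prop) (by fun_prop) (by fun_prop) (by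
      intro x y
      rw [← ENNReal.ofReal_mul (Real.exp_pos _).le, ← ENNReal.ofReal_mul (Real.exp_pos _).le,
        ← Real.exp_add, ← Real.exp_add, ENNReal.ofReal_rpow_of_pos (Real.exp_pos _),
        ENNReal.ofReal_rpow_of_pos (Real.exp_pos _), ← Real.exp_mul, ← Real.exp_mul,
        ← ENNReal.ofReal_mul (Real.exp_pos _).le, ← Real.exp_add]
      apply ENNReal.ofReal_le_ofReal
      apply Real.exp_le_exp.2
      have a1 := strong_conv U m hC2 hHess t s ht hs hts x y
      have a2 := mul_le_mul_of_nonneg_left (hPF x y) ht.le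
      have a3 : (-U y + -(t / s) * F y) * s = - s * U y - t * F y := by field_simp; ring
      rw [a3]
      nlinarith [a1, a2])
  set A := ∫⁻ x, ENNReal.ofReal (Real.exp (P x)) ∂μ with hA
  set B := ∫⁻ x, ENNReal.ofReal (Real.exp (-(t / s) * F x)) ∂μ with hB
  have hA' : ∫⁻ x, ENNReal.ofReal (Real.exp (-U x)) * ENNReal.ofReal (Real.exp (P x)) = Z * A := by
    rw [hA, hμ, dens_lint U hUc _ (by fun_prop), ← hZ, ← mul_assoc, ENNReal.mul_inv_cancel h0 h1, one_mul]
  have hB' : ∫⁻ x, ENNReal.ofReal (Real.exp (-U x)) * ENNReal.ofReal (Real.exp (-(t / s) * F x)) = Z * B := by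
    rw [hB, hμ, dens_lint U hUc _ (by fun_prop), ← hZ, ← mul_assoc, ENNReal.mul_inv_cancel h0 h1, one_mul]
  rw [hA', hB', ENNReal.mul_rpow_of_nonneg _ _ ht.le, ENNReal.mul_rpow_of_nonneg _ _ hs.le,
    mul_mul_mul_comm, ← ENNReal.rpow_add _ _ h0 h1, hts, ENNReal.rpow_one] at hpl
  have hAB : A ^ t * B ^ s ≤ 1 := by
    refine (ENNReal.mul_le_mul_iff_right h0 h1).1 ?_
    simpa using hpl
  have hBE : ENNReal.ofReal (Real.exp (-(t / s) * E)) ≤ B := by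
    have := jensen_exp μ (fun x => -(t / s) * F x) (hFi.const_mul _)
    rwa [integral_const_mul] at this
  have hBs : ENNReal.ofReal (Real.exp (-(t * E))) ≤ B ^ s := by
    have := ENNReal.rpow_le_rpow hBE hs.le
    rw [ENNReal.ofReal_rpow_of_pos (Real.exp_pos _), ← Real.exp_mul] at this
    convert this using 3
    field_simp
  have hAt : A ^ t ≤ ENNReal.ofReal (Real.exp E) ^ t := by
    rw [ENNReal.ofReal_rpow_of_pos (Real.exp_pos _), ← Real.exp_mul]
    calc A ^ t = A ^ t * ENNReal.ofReal (Real.exp (-(t * E))) * ENNReal.ofReal (Real.exp (E * t)) := by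
          rw [mul_assoc, ← ENNReal.ofReal_mul (Real.exp_pos _).le, ← Real.exp_add]
          simp [mul_comm]
      _ ≤ A ^ t * B ^ s * ENNReal.ofReal (Real.exp (E * t)) := by gcongr
      _ ≤ 1 * ENNReal.ofReal (Real.exp (E * t)) := by gcongr
      _ = _ := one_mul _
  have hAE : A ≤ ENNReal.ofReal (Real.exp E) := (ENNReal.rpow_le_rpow_iff ht).1 hAt
  have hi : Integrable (fun x => Real.exp (P x)) μ := by
    refine ⟨by fun_prop, ?_⟩
    rw [hasFiniteIntegral_iff_ofReal (Filter.Eventually.of_forall fun x => (Real.exp_pos _).le)]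
    exact lt_of_le_of_lt hAE ENNReal.ofReal_lt_top
  refine ⟨hi, ?_⟩
  rw [integral_eq_lintegral_of_nonneg_ae (Filter.Eventually.of_forall fun x => (Real.exp_pos _).le) hi.1]
  exact ENNReal.toReal_le_of_le_ofReal (Real.exp_pos _).le hAE

lemma cosh_lower (x : ℝ) : 1 + x ^ 2 / 2 ≤ Real.cosh x := by
  wlog hx : 0 ≤ x generalizing x
  · have := this (-x) (by linarith)
    simpa using this
  have h1 : x / 2 ≤ Real.sinh (x / 2) := Real.self_le_sinh_iff.2 (by linarith)
  have h2 : Real.cosh x = Real.cosh (x / 2) ^ 2 + Real.sinh (x / 2) ^ 2 := by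
    rw [← Real.cosh_two_mul]; congr 1; ring
  rw [h2, Real.cosh_sq]
  nlinarith

set_option maxHeartbeats 400000 in
theorem stmt17 {d : ℕ} (U : EV d → ℝ) (m L : ℝ) (hm : 0 < m)
    (hC2 : ContDiff ℝ 2 U)
    -- ∇²U(θ) ⪰ m I for every θ
    (hHess : ∀ θ v : EV d, m * ‖v‖ ^ 2 ≤ ⟪v, fderiv ℝ (gradient U) θ v⟫)
    (f : EV d → ℝ)
    (hLip : ∀ x y, |f x - f y| ≤ L * ‖x - y‖)
    (hmean : ∫ x, f x ∂(densMeasure fun θ => Real.exp (-U θ)) = 0) :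
    ∀ lam : ℝ, 0 ≤ lam → lam ≤ m / (6 * L ^ 2) →
      ∫ x, Real.exp (lam * (f x ^ 2 -
          ∫ y, f y ^ 2 ∂(densMeasure fun θ => Real.exp (-U θ))))
        ∂(densMeasure fun θ => Real.exp (-U θ)) ≤
      Real.exp (4 * lam ^ 2 * L ^ 4 / m ^ 2) := by
  intro lam hl0 hl
  have hprob := dens_prob U m hm hC2 hHess
  rcases eq_or_lt_of_le hl0 with h | hlpos
  · subst h; simp
  have hL0 : L ≠ 0 := by
    rintro rfl
    simp at hl; linarith
  have hL2 : 0 < L ^ 2 := by positivity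
  have hsq : ∀ x y, (f x - f y) ^ 2 ≤ L ^ 2 * ‖x - y‖ ^ 2 := by
    intro x y
    have := pow_le_pow_left₀ (abs_nonneg _) (hLip x y) 2
    rwa [sq_abs, mul_pow] at this
  have hfc : Continuous f := by
    have : LipschitzWith (Real.toNNReal |L|) f := by
      apply LipschitzWith.of_dist_le_mul
      intro x y
      rw [Real.dist_eq, dist_eq_norm, Real.coe_toNNReal _ (abs_nonneg _)]
      exact (hLip x y).trans (by gcongr; exact le_abs_self _)
    exact this.continuous
  have hf2 : ∀ x, f x ^ 2 ≤ (2 * f 0 ^ 2 + 2 * L ^ 2) * (1 + ‖x‖ ^ 2) := by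
    intro x
    have := hsq x 0
    simp at this
    nlinarith [sq_nonneg (f x - 2 * f 0), sq_nonneg ‖x‖, sq_nonneg (f 0), mul_nonneg (sq_nonneg (f 0)) (sq_nonneg ‖x‖)]
  have hi2 : Integrable (fun x => f x ^ 2) (densMeasure fun θ => Real.exp (-U θ)) :=
    dens_integ U m hm hC2 hHess _ (by fun_prop) _ (fun x => by rw [abs_of_nonneg (sq_nonneg _)]; exact hf2 x)
  have hi1 : Integrable f (densMeasure fun θ => Real.exp (-U θ)) := by
    refine dens_integ U m hm hC2 hHess _ hfc (1 + (2 * f 0 ^ 2 + 2 * L ^ 2)) (fun x => ?_)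
    have h1 := hf2 x
    have h2 : |f x| ≤ 1 + f x ^ 2 := by
      rw [← sq_abs (f x)]; nlinarith [sq_nonneg (|f x| - 1), sq_nonneg (|f x|)]
    nlinarith [sq_nonneg ‖x‖]
  set μ := (densMeasure fun θ => Real.exp (-U θ)) with hμ
  set v := ∫ y, f y ^ 2 ∂μ with hv
  have hv0 : 0 ≤ v := integral_nonneg fun x => sq_nonneg _
  -- the variance bound
  have hsg : ∀ e : ℝ, Integrable (fun x => Real.exp (e * f x)) μ ∧
      ∫ x, Real.exp (e * f x) ∂μ ≤ Real.exp (e ^ 2 * L ^ 2 / (2 * (99 / 100) * m)) := by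
    intro e
    obtain ⟨K, hK⟩ : ∃ K : ℝ, K = e ^ 2 * L ^ 2 / (2 * (99 / 100) * m) := ⟨_, rfl⟩
    have hiK : Integrable (fun x => e * f x + K) μ :=
      Integrable.add (hi1.const_mul e) (integrable_const K)
    rw [← hK]
    have := transport U m hm hC2 hHess (1 / 100) (99 / 100) (by norm_num) (by norm_num) (by norm_num)
      (fun x => e * f x) (fun x => e * f x + K)
      (by fun_prop) (by fun_prop) hiK (by
        intro x y
        set r := ‖x - y‖
        have h1 : e * (f x - f y) ≤ |e| * (|L| * r) := by
          refine (le_abs_self _).trans ?_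
          rw [abs_mul]
          gcongr
          exact (hLip x y).trans (by gcongr; exact le_abs_self _)
        have h2 : e ^ 2 * L ^ 2 / (2 * (99 / 100) * m) + 99 / 100 * m / 2 * r ^ 2 - |e| * (|L| * r)
            = (|e| * |L| - 99 / 100 * m * r) ^ 2 / (2 * (99 / 100) * m) := by
          rw [← sq_abs e, ← sq_abs L]; field_simp; ring
        have h3 : 0 ≤ (|e| * |L| - 99 / 100 * m * r) ^ 2 / (2 * (99 / 100) * m) := by positivity
        simp only [hK]
        linarith)
    rw [integral_add (hi1.const_mul e) (integrable_const _), integral_const_mul, ← hμ, hmean] at this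
    simpa using this
  have hvb : v ≤ 1.13 * (L ^ 2 / m) := by
    set c := L ^ 2 / (2 * (99 / 100) * m) with hc
    have hcpos : 0 < c := by positivity
    set e := Real.sqrt (1 / (10 * c)) with he
    have he2 : e ^ 2 = 1 / (10 * c) := Real.sq_sqrt (by positivity)
    obtain ⟨i1, b1⟩ := hsg e
    obtain ⟨i2, b2⟩ := hsg (-e)
    have hexp : e ^ 2 * L ^ 2 / (2 * (99 / 100) * m) = 1 / 10 := by
      have : e ^ 2 * L ^ 2 / (2 * (99 / 100) * m) = e ^ 2 * c := by rw [hc]; ring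
      rw [this, he2]; field_simp
    rw [neg_sq, hexp] at b2
    rw [hexp] at b1
    have hb3 : Real.exp (1 / 10) ≤ 10 / 9 := by
      have := Real.add_one_le_exp (-(1 / 10 : ℝ))
      rw [Real.exp_neg] at this
      have h2 : (9 / 10 : ℝ) ≤ (Real.exp (1 / 10))⁻¹ := by linarith
      have := inv_anti₀ (by norm_num) h2
      rw [inv_inv] at this
      linarith
    have hmono : ∫ x, (2 + e ^ 2 * f x ^ 2) ∂μ ≤ ∫ x, (Real.exp (e * f x) + Real.exp (-e * f x)) ∂μ := by
      refine integral_mono ((integrable_const _).add (hi2.const_mul _)) (i1.add i2) fun x => ?_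
      have h1 := cosh_lower (e * f x)
      rw [Real.cosh_eq] at h1
      simp only [neg_mul]
      nlinarith [h1]
    rw [integral_add (integrable_const _) (hi2.const_mul _), integral_add i1 i2, integral_const_mul, ← hv, he2] at hmono
    simp only [integral_const, probReal_univ, one_smul] at hmono
    have h5 : 1 / (10 * c) * v ≤ 2 / 9 := by linarith
    have h6 : v ≤ 2 / 9 * (10 * c) := by
      rw [one_div, inv_mul_le_iff₀ (by positivity)] at h5
      linarith
    have h7 : c = (100 / 198) * (L ^ 2 / m) := by rw [hc]; field_simp; norm_num
    rw [h7] at h6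
    have : 0 < L ^ 2 / m := by positivity
    nlinarith
  -- main estimate
  set c1 := (99 / 200) * (m / L ^ 2) with hc1
  have hq : 0 < m / L ^ 2 := by positivity
  have hl' : lam ≤ 1 / 6 * (m / L ^ 2) := by
    refine hl.trans (le_of_eq ?_); field_simp
  have hgap : 0.328 * (m / L ^ 2) ≤ c1 - lam := by
    rw [hc1]; norm_num at *; linarith
  have hgap0 : 0 < c1 - lam := lt_of_lt_of_le (by positivity) hgap
  set a := lam * c1 / (c1 - lam) with ha
  obtain ⟨i3, b3⟩ := transport U m hm hC2 hHess (1 / 100) (99 / 100) (by norm_num) (by norm_num) (by norm_num)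
      (fun x => lam * f x ^ 2) (fun x => a * f x ^ 2)
      (by fun_prop) (by fun_prop) (hi2.const_mul _) (by
        intro x y
        have h1 := hsq x y
        have h2 : c1 * (f x - f y) ^ 2 ≤ 99 / 100 * m / 2 * ‖x - y‖ ^ 2 := by
          calc c1 * (f x - f y) ^ 2 ≤ c1 * (L ^ 2 * ‖x - y‖ ^ 2) := by gcongr
            _ = _ := by rw [hc1]; field_simp; ring
        have h3 : a * f y ^ 2 + c1 * (f x - f y) ^ 2 - lam * f x ^ 2 
            = ((c1 - lam) * f x - c1 * f y) ^ 2 / (c1 - lam) := by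
          rw [ha]; field_simp; ring
        have h4 : 0 ≤ ((c1 - lam) * f x - c1 * f y) ^ 2 / (c1 - lam) := by positivity
        linarith)
  rw [← hμ, integral_const_mul, ← hv] at b3
  have e1 : ∀ x, Real.exp (lam * (f x ^ 2 - v)) = Real.exp (-(lam * v)) * Real.exp (lam * f x ^ 2) := by
    intro x; rw [← Real.exp_add]; congr 1; ring
  simp only [e1]
  rw [integral_const_mul]
  refine (mul_le_mul_of_nonneg_left b3 (Real.exp_pos _).le).trans ?_
  rw [← Real.exp_add]
  apply Real.exp_le_exp.2
  have e2 : -(lam * v) + a * v = lam ^ 2 * v / (c1 - lam) := by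
    rw [ha]; field_simp; ring
  rw [e2, div_le_iff₀ hgap0]
  calc lam ^ 2 * v ≤ lam ^ 2 * (1.13 * (L ^ 2 / m)) := by gcongr
    _ ≤ lam ^ 2 * (4 * 0.328 * (L ^ 2 / m)) := by gcongr; norm_num
    _ = 4 * lam ^ 2 * L ^ 4 / m ^ 2 * (0.328 * (m / L ^ 2)) := by field_simp
    _ ≤ _ := by gcongr

end
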